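/- Let A, B be k-algebras, τ : B ⊗ A → A ⊗ B a twisting map, and let ι_A : A → A ⊗_τ B and ι_B : B → A ⊗_τ B be given by ι_A(a) = a ⊗ 1 and ι_B(b) = 1 ⊗ b. If Λ is a k-algebra and i_A : A → Λ, i_B : B → Λ are k-algebra morphisms satisfying ∇_Λ ∘ (i_B ⊗ i_A) = ∇_Λ ∘ (i_A ⊗ i_B) ∘ τ as maps B ⊗ A → Λ, then there is a unique k-linear map h : A ⊗ B → Λ such that h(1 ⊗ 1) = 1, h ∘ ∇_τ = ∇_Λ ∘ (h ⊗ h) (i.e., h is an algebra morphism from A ⊗_τ B to Λ), h ∘ ι_A = i_A, and h ∘ ι_B = i_B. -/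

import Mathlib

open TensorProduct

section TTPDefs

variable (k : Type*) [Field k]
variable {A B : Type*} [AddCommGroup A] [Module k A] [AddCommGroup B] [Module k B]

/-- The rearrangement `1 ⊗ τ ⊗ 1 : (A ⊗ B) ⊗ (A ⊗ B) → (A ⊗ A) ⊗ (B ⊗ B)`. -/
noncomputable def middleTwist (τ : B ⊗[k] A →ₗ[k] A ⊗[k] B) :
    (A ⊗[k] B) ⊗[k] (A ⊗[k] B) →ₗ[k] (A ⊗[k] A) ⊗[k] (B ⊗[k] B) :=
  (TensorProduct.assoc k A A (B ⊗[k] B)).symm.toLinearMap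
    ∘ₗ TensorProduct.map (LinearMap.id : A →ₗ[k] A) (TensorProduct.assoc k A B B).toLinearMap
    ∘ₗ TensorProduct.map (LinearMap.id : A →ₗ[k] A)
        (TensorProduct.map τ (LinearMap.id : B →ₗ[k] B))
    ∘ₗ TensorProduct.map (LinearMap.id : A →ₗ[k] A)
        (TensorProduct.assoc k B A B).symm.toLinearMap
    ∘ₗ (TensorProduct.assoc k A B (A ⊗[k] B)).toLinearMap

/-- The twisted tensor product multiplication `∇_τ = (mA ⊗ mB) ∘ (1 ⊗ τ ⊗ 1)` on `A ⊗ B`,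
for given multiplication maps `mA`, `mB`. -/
noncomputable def ttpMul (mA : A ⊗[k] A →ₗ[k] A) (mB : B ⊗[k] B →ₗ[k] B)
    (τ : B ⊗[k] A →ₗ[k] A ⊗[k] B) :
    (A ⊗[k] B) ⊗[k] (A ⊗[k] B) →ₗ[k] A ⊗[k] B :=
  TensorProduct.map mA mB ∘ₗ middleTwist k τ

/-- The rearrangement `1 ⊗ τ ⊗ 1 : (B ⊗ B) ⊗ (A ⊗ A) → (B ⊗ A) ⊗ (B ⊗ A)`. -/
noncomputable def preTwist (τ : B ⊗[k] A →ₗ[k] A ⊗[k] B) :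
    (B ⊗[k] B) ⊗[k] (A ⊗[k] A) →ₗ[k] (B ⊗[k] A) ⊗[k] (B ⊗[k] A) :=
  (TensorProduct.assoc k B A (B ⊗[k] A)).symm.toLinearMap
    ∘ₗ TensorProduct.map (LinearMap.id : B →ₗ[k] B) (TensorProduct.assoc k A B A).toLinearMap
    ∘ₗ TensorProduct.map (LinearMap.id : B →ₗ[k] B)
        (TensorProduct.map τ (LinearMap.id : A →ₗ[k] A))
    ∘ₗ TensorProduct.map (LinearMap.id : B →ₗ[k] B)
        (TensorProduct.assoc k B A A).symm.toLinearMap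
    ∘ₗ (TensorProduct.assoc k B B (A ⊗[k] A)).toLinearMap

/-- `τ : B ⊗ A → A ⊗ B` is a twisting map with respect to the given units `uA`, `uB` and
multiplication maps `mA`, `mB`: it is bijective, compatible with the units, and
`τ ∘ (mB ⊗ mA) = (mA ⊗ mB) ∘ (1 ⊗ τ ⊗ 1) ∘ (τ ⊗ τ) ∘ (1 ⊗ τ ⊗ 1)`. -/
def IsTwistingMapGen (uA : A) (mA : A ⊗[k] A →ₗ[k] A) (uB : B) (mB : B ⊗[k] B →ₗ[k] B)
    (τ : B ⊗[k] A →ₗ[k] A ⊗[k] B) : Prop :=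
  Function.Bijective τ ∧
  (∀ b : B, τ (b ⊗ₜ[k] uA) = uA ⊗ₜ[k] b) ∧
  (∀ a : A, τ (uB ⊗ₜ[k] a) = a ⊗ₜ[k] uB) ∧
  τ ∘ₗ TensorProduct.map mB mA
    = ttpMul k mA mB τ ∘ₗ TensorProduct.map τ τ ∘ₗ preTwist k τ

end TTPDefs

/-- A twisting map between two `k`-algebras `A` and `B`. -/
def IsTwistingMap (k : Type*) [Field k] {A B : Type*}
    [Ring A] [Algebra k A] [Ring B] [Algebra k B]
    (τ : B ⊗[k] A →ₗ[k] A ⊗[k] B) : Prop :=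
  IsTwistingMapGen k (1 : A) (LinearMap.mul' k A) (1 : B) (LinearMap.mul' k B) τ

/-- The product `(a ⊗ b) (a' ⊗ b')` in the twisted tensor product, with `τ (b ⊗ a')` kept as a
single tensor. -/
lemma ttpMul_tmul_tmul {k A B : Type*} [Field k] [AddCommGroup A] [Module k A]
    [AddCommGroup B] [Module k B] (mA : A ⊗[k] A →ₗ[k] A) (mB : B ⊗[k] B →ₗ[k] B)
    (τ : B ⊗[k] A →ₗ[k] A ⊗[k] B) (a a' : A) (b b' : B) :
    ttpMul k mA mB τ ((a ⊗ₜ[k] b) ⊗ₜ[k] (a' ⊗ₜ[k] b'))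
      = TensorProduct.map mA mB ((TensorProduct.assoc k A A (B ⊗[k] B)).symm
          (a ⊗ₜ[k] TensorProduct.assoc k A B B (τ (b ⊗ₜ[k] a') ⊗ₜ[k] b'))) := by
  simp [ttpMul, middleTwist]

/-- Multiplying a tensor `x` by `a` on the left and by `b` on the right commutes with
`∇_Λ ∘ (i_A ⊗ i_B)`. -/
lemma mul'_map_map_mul' {k A B Λ : Type*} [Field k]
    [Ring A] [Algebra k A] [Ring B] [Algebra k B] [Ring Λ] [Algebra k Λ]
    (iA : A →ₐ[k] Λ) (iB : B →ₐ[k] Λ) (a : A) (x : A ⊗[k] B) (b : B) :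
    LinearMap.mul' k Λ (TensorProduct.map iA.toLinearMap iB.toLinearMap
      (TensorProduct.map (LinearMap.mul' k A) (LinearMap.mul' k B)
        ((TensorProduct.assoc k A A (B ⊗[k] B)).symm
          (a ⊗ₜ[k] TensorProduct.assoc k A B B (x ⊗ₜ[k] b)))))
      = iA a * LinearMap.mul' k Λ (TensorProduct.map iA.toLinearMap iB.toLinearMap x) * iB b := by
  induction x with
  | zero => simp
  | tmul a' b' => simp [mul_assoc]
  | add x y hx hy =>
    simp only [TensorProduct.add_tmul, TensorProduct.tmul_add, map_add, hx, hy, mul_add, add_mul]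

/-!
Statement 7: Universal property of the twisted tensor product.  If `i_A : A → Λ` and
`i_B : B → Λ` are algebra morphisms with `∇_Λ ∘ (i_B ⊗ i_A) = ∇_Λ ∘ (i_A ⊗ i_B) ∘ τ`,
then there is a unique algebra morphism `h : A ⊗_τ B → Λ` with `h ∘ ι_A = i_A` and
`h ∘ ι_B = i_B`.
-/

theorem twisted_tensor_product_universal_property
    {k A B Λ : Type*} [Field k]
    [Ring A] [Algebra k A] [Ring B] [Algebra k B] [Ring Λ] [Algebra k Λ]
    (τ : B ⊗[k] A →ₗ[k] A ⊗[k] B) (hτ : IsTwistingMap k τ)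
    (iA : A →ₐ[k] Λ) (iB : B →ₐ[k] Λ)
    (hcomm : LinearMap.mul' k Λ ∘ₗ TensorProduct.map iB.toLinearMap iA.toLinearMap
      = (LinearMap.mul' k Λ ∘ₗ TensorProduct.map iA.toLinearMap iB.toLinearMap) ∘ₗ τ) :
    ∃! h : A ⊗[k] B →ₗ[k] Λ,
      -- `h` is an algebra morphism from `A ⊗_τ B` to `Λ` …
      h ((1 : A) ⊗ₜ[k] (1 : B)) = 1 ∧
      h ∘ₗ ttpMul k (LinearMap.mul' k A) (LinearMap.mul' k B) τ
        = LinearMap.mul' k Λ ∘ₗ TensorProduct.map h h ∧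
      -- … compatible with the inclusions `ι_A : a ↦ a ⊗ 1` and `ι_B : b ↦ 1 ⊗ b`
      (∀ a : A, h (a ⊗ₜ[k] (1 : B)) = iA a) ∧
      (∀ b : B, h ((1 : A) ⊗ₜ[k] b) = iB b) := by
  obtain ⟨-, hA, -, -⟩ := hτ
  refine ⟨LinearMap.mul' k Λ ∘ₗ TensorProduct.map iA.toLinearMap iB.toLinearMap,
    ⟨by simp, ?_, by simp, by simp⟩, ?_⟩
  · refine TensorProduct.ext_fourfold' fun a b a' b' => ?_
    have h := LinearMap.congr_fun hcomm (b ⊗ₜ[k] a')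
    simp only [LinearMap.comp_apply] at h
    simp only [LinearMap.comp_apply, ttpMul_tmul_tmul, mul'_map_map_mul', ← h]
    simp [mul_assoc]
  · rintro g ⟨-, hmul, hgA, hgB⟩
    refine TensorProduct.ext' fun a b => ?_
    have h := LinearMap.congr_fun hmul ((a ⊗ₜ[k] (1 : B)) ⊗ₜ[k] ((1 : A) ⊗ₜ[k] b))
    simpa [ttpMul_tmul_tmul, hA, hgA, hgB] using h
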